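/- Let α ∈ (1,2), let n, p, q ≥ 1 be integers, and let w > 0. Set A = I_p ⊗ (w·G_n^{(α)}) ⊗ I_q and B = I_p ⊗ (w·τ(G_n^{(α)})) ⊗ I_q, where ⊗ denotes the Kronecker product and I_p, I_q are identity matrices. If λ ∈ ℝ and z is a nonzero real vector of size p·n·q with A·z = λ·B·z, then 1/2 < λ < 3/2. -/

import Mathlib

open Kronecker

/-- Grünwald–Letnikov coefficients: `g 0 = 1`, `g k = (1 - (α+1)/k) * g (k-1)` for `k ≥ 1`. -/
noncomputable def glCoef (α : ℝ) : ℕ → ℝ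
  | 0 => 1
  | k + 1 => (1 - (α + 1) / ((k : ℝ) + 1)) * glCoef α k

/-- First-column entries of `G_n^{(α)}`: `t_0 = -2g_1`, `t_1 = -(g_0+g_2)`, `t_k = -g_{k+1}` for `k ≥ 2`. -/
noncomputable def tC (α : ℝ) : ℕ → ℝ
  | 0 => -2 * glCoef α 1
  | 1 => -(glCoef α 0 + glCoef α 2)
  | k + 2 => -glCoef α (k + 3)

/-- Padded coefficients: `t_k` for `k < n`, `0` for `k ≥ n`. -/
noncomputable def tpad (n : ℕ) (t : ℕ → ℝ) (k : ℕ) : ℝ := if k < n then t k else 0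

/-- The `n×n` symmetric Toeplitz matrix with `(i,j)` entry `t_{|i-j|}`. -/
noncomputable def toeplitzM (n : ℕ) (t : ℕ → ℝ) : Matrix (Fin n) (Fin n) ℝ :=
  fun i j => t (Nat.dist i.val j.val)

/-- The Hankel matrix `(H_n)_{ij} = t_{i+j} + t_{2(n+1)-(i+j)}` (1-based indices,
with the convention `t_k = 0` for `k ≥ n`). Here `i j : Fin n` are 0-based. -/
noncomputable def hankelM (n : ℕ) (t : ℕ → ℝ) : Matrix (Fin n) (Fin n) ℝ :=
  fun i j => tpad n t (i.val + j.val + 2) + tpad n t (2 * n - (i.val + j.val))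

/-- The τ-matrix `τ(T_n) = T_n - H_n`. -/
noncomputable def tauM (n : ℕ) (t : ℕ → ℝ) : Matrix (Fin n) (Fin n) ℝ :=
  toeplitzM n t - hankelM n t

/-- The matrix `G_n^{(α)}`. -/
noncomputable def Gmat (α : ℝ) (n : ℕ) : Matrix (Fin n) (Fin n) ℝ := toeplitzM n (tC α)

open Matrix Finset in
/-- If the symmetric matrix `K` has positive row sums and bounds `M` from below in the sense that
`K i i ≤ M i i` and `|M i j| ≤ -K i j` off the diagonal, then `M` has a positive quadratic form. -/
theorem dotProduct_mulVec_pos_of_comparison {ι : Type*} [Fintype ι] {M K : Matrix ι ι ℝ}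
    (hK : ∀ i j, K i j = K j i) (hrow : ∀ i, 0 < ∑ j, K i j) (hdiag : ∀ i, K i i ≤ M i i)
    (hoff : ∀ i j, i ≠ j → |M i j| ≤ -K i j) {v : ι → ℝ} (hv : v ≠ 0) :
    0 < v ⬝ᵥ M *ᵥ v := by
  have hpt : ∀ i j, K i j * v i ^ 2 / 2 + K j i * v j ^ 2 / 2 ≤ v i * (M i j * v j) := by
    intro i j
    rw [hK j i]
    rcases eq_or_ne i j with rfl | hij
    · nlinarith [mul_nonneg (sub_nonneg.2 (hdiag i)) (sq_nonneg (v i))]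
    · obtain ⟨h1, h2⟩ := abs_le.1 (hoff i j hij)
      nlinarith [mul_nonneg (sub_nonneg.2 h1) (sq_nonneg (v i + v j)),
        mul_nonneg (sub_nonneg.2 h2) (sq_nonneg (v i - v j))]
  have hsum : ∑ i, (∑ j, K i j) * v i ^ 2
      = ∑ i, ∑ j, (K i j * v i ^ 2 / 2 + K j i * v j ^ 2 / 2) := by
    simp only [sum_add_distrib]
    rw [sum_comm (f := fun i j => K j i * v j ^ 2 / 2), ← sum_add_distrib]
    refine sum_congr rfl fun i _ => ?_
    rw [← sum_add_distrib, sum_mul]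
    exact sum_congr rfl fun j _ => by ring
  obtain ⟨k, hk⟩ := Function.ne_iff.1 hv
  have hpos : 0 < ∑ i, (∑ j, K i j) * v i ^ 2 :=
    sum_pos' (fun i _ => mul_nonneg (hrow i).le (sq_nonneg _))
      ⟨k, mem_univ k, mul_pos (hrow k) (sq_pos_of_ne_zero hk)⟩
  refine hpos.trans_le (hsum.trans_le ?_)
  simp only [dotProduct, mulVec, mul_sum]
  exact sum_le_sum fun i _ => sum_le_sum fun j _ => hpt i j

theorem glCoef_succ (α : ℝ) (k : ℕ) :
    ((k : ℝ) + 1) * glCoef α (k + 1) = (k - α) * glCoef α k := by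
  rw [glCoef]
  field_simp
  ring

theorem glCoef_add_two_pos {α : ℝ} (hα : α ∈ Set.Ioo (1 : ℝ) 2) (k : ℕ) :
    0 < glCoef α (k + 2) := by
  obtain ⟨h1, h2⟩ := hα
  induction k with
  | zero => norm_num [glCoef]; nlinarith
  | succ k ih =>
    have h := glCoef_succ α (k + 2)
    push_cast at h
    have hk : (0 : ℝ) ≤ k := k.cast_nonneg
    refine pos_of_mul_pos_right (a := (k : ℝ) + 2 + 1) ?_ (by positivity)
    rw [h]
    exact mul_pos (by linarith) ih

theorem glCoef_add_three_le {α : ℝ} (hα : α ∈ Set.Ioo (1 : ℝ) 2) (k : ℕ) :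
    glCoef α (k + 3) ≤ glCoef α (k + 2) := by
  have h := glCoef_succ α (k + 2)
  have hp := glCoef_add_two_pos hα k
  have hk : (0 : ℝ) ≤ k := k.cast_nonneg
  push_cast at h
  refine le_of_mul_le_mul_left (a := (k : ℝ) + 2 + 1) ?_ (by positivity)
  rw [h]
  nlinarith [hα.1]

theorem mul_sum_glCoef (α : ℝ) (n : ℕ) :
    α * ∑ k ∈ Finset.range (n + 1), glCoef α k = -(((n : ℝ) + 1) * glCoef α (n + 1)) := by
  induction n with
  | zero => simp [glCoef]
  | succ n ih =>
    rw [Finset.sum_range_succ, mul_add, ih, glCoef_succ α (n + 1)]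
    push_cast
    ring

theorem sum_glCoef_neg {α : ℝ} (hα : α ∈ Set.Ioo (1 : ℝ) 2) (n : ℕ) :
    ∑ k ∈ Finset.range (n + 2), glCoef α k < 0 := by
  have h := mul_sum_glCoef α (n + 1)
  have hp := glCoef_add_two_pos hα n
  have hα0 : 0 < α := by linarith [hα.1]
  refine neg_of_mul_neg_right (a := α) ?_ hα0.le
  rw [h]
  have : (0 : ℝ) < ((n + 1 : ℕ) : ℝ) + 1 := by positivity
  exact neg_neg_of_pos (mul_pos this hp)

theorem tC_succ_nonpos {α : ℝ} (hα : α ∈ Set.Ioo (1 : ℝ) 2) (k : ℕ) : tC α (k + 1) ≤ 0 := by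
  cases k with
  | zero =>
    have h := glCoef_add_two_pos hα 0
    have h0 : glCoef α 0 = 1 := rfl
    simp only [tC]
    linarith
  | succ k => simpa [tC] using (glCoef_add_two_pos hα (k + 1)).le

theorem monotone_tC_succ {α : ℝ} (hα : α ∈ Set.Ioo (1 : ℝ) 2) :
    Monotone fun k => tC α (k + 1) := by
  refine monotone_nat_of_le_succ fun k => ?_
  cases k with
  | zero =>
    have h := glCoef_add_three_le hα 0
    have h0 : glCoef α 0 = 1 := rfl
    simp only [tC]
    linarith
  | succ k => simpa [tC] using glCoef_add_three_le hα (k + 1)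

theorem sum_tC (α : ℝ) (n : ℕ) :
    ∑ k ∈ Finset.range (n + 2), tC α k
      = -glCoef α 1 - ∑ k ∈ Finset.range (n + 3), glCoef α k := by
  induction n with
  | zero => simp [Finset.sum_range_succ, tC]; ring
  | succ n ih =>
    rw [Finset.sum_range_succ, ih, Finset.sum_range_succ _ (n + 3), tC]
    ring

theorem tC_zero_lt_two_mul_sum {α : ℝ} (hα : α ∈ Set.Ioo (1 : ℝ) 2) {n : ℕ} (hn : 1 ≤ n) :
    tC α 0 < 2 * ∑ k ∈ Finset.range n, tC α k := by
  match n, hn with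
  | 1, _ =>
    simp [tC, glCoef]
    linarith [hα.1]
  | n + 2, _ =>
    rw [sum_tC, tC]
    linarith [sum_glCoef_neg hα (n + 1)]

theorem sum_range_tpad_of_le {n m : ℕ} (t : ℕ → ℝ) (h : n ≤ m) :
    ∑ k ∈ Finset.range m, tpad n t k = ∑ k ∈ Finset.range n, t k := by
  rw [← Finset.sum_subset (Finset.range_mono h)]
  · exact Finset.sum_congr rfl fun k hk => if_pos (Finset.mem_range.1 hk)
  · exact fun k _ hk => if_neg (by simpa using hk)

theorem sum_range_shift (f : ℕ → ℝ) (a m : ℕ) :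
    ∑ j ∈ Finset.range m, f (a + j)
      = ∑ k ∈ Finset.range (a + m), f k - ∑ k ∈ Finset.range a, f k := by
  rw [Finset.sum_range_add]
  ring

theorem sum_range_dist (f : ℕ → ℝ) {n i : ℕ} (hi : i < n) :
    ∑ j ∈ Finset.range n, f (Nat.dist i j)
      = ∑ k ∈ Finset.range (i + 1), f k + ∑ k ∈ Finset.range (n - i), f k - f 0 := by
  obtain ⟨m, rfl⟩ := Nat.exists_eq_add_of_lt hi
  rw [show i + m + 1 = (i + 1) + m by ring, Finset.sum_range_add,
    ← Finset.sum_range_reflect f (i + 1), show i + 1 + m - i = m + 1 by omega,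
    Finset.sum_range_succ' f m, add_sub_assoc, add_sub_cancel_right]
  congr 1
  · refine Finset.sum_congr rfl fun j hj => ?_
    rw [Finset.mem_range] at hj
    rw [Nat.dist_eq_sub_of_le_right (by omega), show i + 1 - 1 - j = i - j by omega]
  · refine Finset.sum_congr rfl fun j _ => ?_
    rw [Nat.dist_eq_sub_of_le (by omega), show i + 1 + j - i = j + 1 by omega]

theorem toeplitzM_symm (n : ℕ) (t : ℕ → ℝ) (i j : Fin n) :
    toeplitzM n t i j = toeplitzM n t j i := by
  simp only [toeplitzM, Nat.dist_comm]

theorem hankelM_symm (n : ℕ) (t : ℕ → ℝ) (i j : Fin n) :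
    hankelM n t i j = hankelM n t j i := by
  simp only [hankelM, add_comm (i : ℕ)]

theorem tpad_succ_nonpos {t : ℕ → ℝ} (ht : ∀ k, t (k + 1) ≤ 0) (n k : ℕ) :
    tpad n t (k + 1) ≤ 0 := by
  unfold tpad
  split_ifs
  exacts [ht k, le_rfl]

theorem tpad_nonpos {t : ℕ → ℝ} (ht : ∀ k, t (k + 1) ≤ 0) (n : ℕ) {k : ℕ} (hk : k ≠ 0) :
    tpad n t k ≤ 0 := by
  obtain ⟨k, rfl⟩ := Nat.exists_eq_succ_of_ne_zero hk
  exact tpad_succ_nonpos ht n k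

theorem hankelM_nonpos {t : ℕ → ℝ} (ht : ∀ k, t (k + 1) ≤ 0) {n : ℕ} (i j : Fin n) :
    hankelM n t i j ≤ 0 :=
  add_nonpos (tpad_nonpos ht n (by omega)) (tpad_nonpos ht n (by omega))

/-- Off the diagonal, the Hankel correction is dominated by the Toeplitz matrix, because at most
one of its two terms is nonzero. -/
theorem toeplitzM_le_hankelM {t : ℕ → ℝ} (ht : ∀ k, t (k + 1) ≤ 0)
    (hmono : Monotone fun k => t (k + 1)) {n : ℕ} {i j : Fin n} (hij : i ≠ j) :
    toeplitzM n t i j ≤ hankelM n t i j := by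
  have hle : ∀ {a b : ℕ}, 0 < a → a ≤ b → t a ≤ t b := by
    intro a b ha hab
    have h := hmono (Nat.sub_le_sub_right hab 1)
    simpa only [Nat.sub_add_cancel ha, Nat.sub_add_cancel (ha.trans_le hab)] using h
  have hne : (i : ℕ) ≠ j := Fin.val_ne_of_ne hij
  have hd : 0 < Nat.dist i j := Nat.dist_pos_of_ne hne
  have h1 : Nat.dist i j ≤ i + j + 2 := by unfold Nat.dist; omega
  have h2 : Nat.dist i j ≤ 2 * n - (i + j) := by unfold Nat.dist; omega
  have h0 : t (Nat.dist i j) ≤ 0 := by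
    simpa only [Nat.sub_add_cancel hd] using ht (Nat.dist i j - 1)
  simp only [toeplitzM, hankelM, tpad]
  split_ifs
  · omega
  · simpa using hle hd h1
  · simpa using hle hd h2
  · simpa using h0

theorem sum_toeplitzM_add_hankelM {n : ℕ} (t : ℕ → ℝ) (i : Fin n) :
    ∑ j, (toeplitzM n t + hankelM n t) i j
      = 2 * ∑ k ∈ Finset.range n, t k - t 0 - tpad n t (i + 1) - tpad n t (n - i) := by
  obtain ⟨i, hi⟩ := i
  have hT : ∑ j : Fin n, toeplitzM n t ⟨i, hi⟩ j
      = ∑ j ∈ Finset.range n, tpad n t (Nat.dist i j) := by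
    rw [← Fin.sum_univ_eq_sum_range]
    refine Finset.sum_congr rfl fun j _ => (if_pos ?_).symm
    unfold Nat.dist
    omega
  have h1 : ∑ j : Fin n, tpad n t (i + j + 2)
      = ∑ j ∈ Finset.range n, tpad n t (i + 2 + j) := by
    rw [← Fin.sum_univ_eq_sum_range fun j => tpad n t (i + 2 + j)]
    exact Finset.sum_congr rfl fun j _ => by rw [add_right_comm]
  have h2 : ∑ j : Fin n, tpad n t (2 * n - (i + j))
      = ∑ j ∈ Finset.range n, tpad n t (n - i + 1 + j) := by
    rw [Fin.sum_univ_eq_sum_range fun j => tpad n t (2 * n - (i + j)),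
      ← Finset.sum_range_reflect]
    refine Finset.sum_congr rfl fun j hj => ?_
    rw [Finset.mem_range] at hj
    congr 1
    omega
  have h0 : tpad n t 0 = t 0 := if_pos (by omega)
  simp only [Matrix.add_apply, hankelM, Finset.sum_add_distrib]
  rw [hT, h1, h2, sum_range_dist _ hi, sum_range_shift, sum_range_shift, h0,
    sum_range_tpad_of_le t (show n ≤ i + 2 + n by omega),
    sum_range_tpad_of_le t (show n ≤ n - i + 1 + n by omega),
    Finset.sum_range_succ _ (i + 1), Finset.sum_range_succ _ (n - i)]
  ring

open Matrix in
/-- A generalized eigenvalue of the pencil `(T, τ(T))` lies in `(1/2, 3/2)` when the off-diagonal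
Toeplitz coefficients are nonpositive and increasing, with a strictly dominant diagonal. -/
theorem toeplitzM_tauM_eigenvalue_mem {n : ℕ} {t : ℕ → ℝ} (ht : ∀ k, t (k + 1) ≤ 0)
    (hmono : Monotone fun k => t (k + 1)) (hdom : t 0 < 2 * ∑ k ∈ Finset.range n, t k)
    {lam : ℝ} {v : Fin n → ℝ} (hv : v ≠ 0)
    (h : toeplitzM n t *ᵥ v = lam • tauM n t *ᵥ v) : 1 / 2 < lam ∧ lam < 3 / 2 := by
  have hsymm : ∀ i j, (toeplitzM n t + hankelM n t) i j
      = (toeplitzM n t + hankelM n t) j i := fun i j => by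
    rw [Matrix.add_apply, Matrix.add_apply, toeplitzM_symm, hankelM_symm]
  have hrow : ∀ i, 0 < ∑ j, (toeplitzM n t + hankelM n t) i j := fun i => by
    rw [sum_toeplitzM_add_hankelM]
    linarith [tpad_succ_nonpos ht n i, tpad_nonpos ht n (k := n - i) (by omega)]
  have hplus : 0 < v ⬝ᵥ (toeplitzM n t + hankelM n t) *ᵥ v :=
    dotProduct_mulVec_pos_of_comparison hsymm hrow (fun _ => le_rfl)
      (fun i j hij => (abs_of_nonpos (add_nonpos
        ((toeplitzM_le_hankelM ht hmono hij).trans (hankelM_nonpos ht i j))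
        (hankelM_nonpos ht i j))).le) hv
  have hminus : 0 < v ⬝ᵥ (toeplitzM n t - (3 : ℝ) • hankelM n t) *ᵥ v := by
    refine dotProduct_mulVec_pos_of_comparison hsymm hrow (fun i => ?_) (fun i j hij => ?_) hv
    · have := hankelM_nonpos ht i i
      simp only [Matrix.add_apply, Matrix.sub_apply, Matrix.smul_apply, smul_eq_mul]
      linarith
    · have h1 := hankelM_nonpos ht i j
      have h2 := toeplitzM_le_hankelM ht hmono hij
      simp only [Matrix.add_apply, Matrix.sub_apply, Matrix.smul_apply, smul_eq_mul, abs_le]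
      constructor <;> linarith
  have hquad := congrArg (v ⬝ᵥ ·) h
  simp only [tauM, sub_mulVec, dotProduct_sub, dotProduct_smul, smul_eq_mul] at hquad
  rw [add_mulVec, dotProduct_add] at hplus
  rw [sub_mulVec, smul_mulVec, dotProduct_sub, dotProduct_smul, smul_eq_mul] at hminus
  set a := v ⬝ᵥ toeplitzM n t *ᵥ v
  set b := v ⬝ᵥ hankelM n t *ᵥ v
  have hab : 0 < a - b := by linarith
  constructor
  · refine lt_of_mul_lt_mul_right ?_ hab.le
    linarith
  · refine lt_of_mul_lt_mul_right ?_ hab.le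
    linarith

open Matrix in
theorem one_kronecker_kronecker_one_mulVec {ι κ μ R : Type*} [Fintype ι] [Fintype κ] [Fintype μ]
    [DecidableEq ι] [DecidableEq μ] [CommSemiring R] (M : Matrix κ κ R) (z : (ι × κ) × μ → R)
    (a : ι) (i : κ) (b : μ) :
    ((((1 : Matrix ι ι R) ⊗ₖ M) ⊗ₖ (1 : Matrix μ μ R)) *ᵥ z) ((a, i), b)
      = (M *ᵥ fun k => z ((a, k), b)) i := by
  simp [mulVec, dotProduct, Fintype.sum_prod_type, kroneckerMap_apply, one_apply, ite_mul,
    Finset.sum_ite_eq]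

theorem kron_tauInv_spectrum (α : ℝ) (hα : α ∈ Set.Ioo (1 : ℝ) 2)
    (n p q : ℕ) (hn : 1 ≤ n) (hp : 1 ≤ p) (hq : 1 ≤ q) (w : ℝ) (hw : 0 < w)
    (lam : ℝ) (z : (Fin p × Fin n) × Fin q → ℝ) (hz : z ≠ 0)
    (h : (((1 : Matrix (Fin p) (Fin p) ℝ) ⊗ₖ (w • Gmat α n)) ⊗ₖ
            (1 : Matrix (Fin q) (Fin q) ℝ)).mulVec z =
         lam • ((((1 : Matrix (Fin p) (Fin p) ℝ) ⊗ₖ (w • tauM n (tC α))) ⊗ₖ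
            (1 : Matrix (Fin q) (Fin q) ℝ)).mulVec z)) :
    1 / 2 < lam ∧ lam < 3 / 2 := by
  obtain ⟨⟨⟨a, i⟩, b⟩, hz'⟩ := Function.ne_iff.1 hz
  have hv : (fun k => z ((a, k), b)) ≠ 0 := Function.ne_iff.2 ⟨i, hz'⟩
  refine toeplitzM_tauM_eigenvalue_mem (tC_succ_nonpos hα) (monotone_tC_succ hα)
    (tC_zero_lt_two_mul_sum hα hn) hv (funext fun k => ?_)
  have hk := congrFun h ((a, k), b)
  rw [Pi.smul_apply, one_kronecker_kronecker_one_mulVec, one_kronecker_kronecker_one_mulVec,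
    Matrix.smul_mulVec, Matrix.smul_mulVec, Pi.smul_apply, Pi.smul_apply, smul_comm lam w] at hk
  exact smul_right_injective ℝ hw.ne' hk
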